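/- arXiv:2506.12718 — 2 statements merged into one kernel-verified Lean document; each statement's English description precedes it below -/
import Mathlib

section
/- Let d ≥ 1 and let n : {0,…,d−1} → ℕ assign a size n_i ≥ 1 to each coordinate. Suppose for each i that the DFT matrix F_{n_i} factors as F_{n_i} = A_i · P_i with A_i an n_i×n_i complex matrix and P_i a symmetric permutation matrix. Then for all complex vectors g, x indexed by tuples j ∈ Π_{i<d} {0,…,n_i−1}: K(i ↦ conj(F_{n_i})) · (g ∘ (K(i ↦ F_{n_i}) · x)) = K(i ↦ conj(A_i)) · ((K(i ↦ P_i) · g) ∘ (K(i ↦ A_iᵀ) · x)). Dividing both sides by N = Π_{i<d} n_i identifies the left-hand side with the d-dimensional discrete convolution K(F)⁻¹ · diag(g) · K(F) · x, since K(i ↦ F_{n_i})⁻¹ = (1/N) • K(i ↦ conj(F_{n_i})). -/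
open Matrix Complex

/-- The primitive root `ω_n = exp(−2πi/n)`. -/
noncomputable def ω (n : ℕ) : ℂ := Complex.exp (-(2 * Real.pi * Complex.I) / n)

/-- The `n × n` DFT matrix with 0-based entries `(F_n)_{jk} = ω_n^{j·k}`. -/
noncomputable def dftMatrix (n : ℕ) : Matrix (Fin n) (Fin n) ℂ :=
  fun j k => ω n ^ (j.val * k.val)

/-- The `d`-fold Kronecker product on tuple indices:
`K(M)_{j,k} = Π_{i<d} (M_i)_{j_i, k_i}`. -/
noncomputable def kron {d : ℕ} {n : Fin d → ℕ}
    (M : ∀ i : Fin d, Matrix (Fin (n i)) (Fin (n i)) ℂ) :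
    Matrix (∀ i : Fin d, Fin (n i)) (∀ i : Fin d, Fin (n i)) ℂ :=
  fun j k => ∏ i : Fin d, M i (j i) (k i)

theorem isPrimitiveRoot_ω {n : ℕ} (hn : n ≠ 0) : IsPrimitiveRoot (ω n) n := by
  have h : ω n = (Complex.exp (2 * Real.pi * Complex.I / n))⁻¹ := by
    rw [ω, ← Complex.exp_neg, neg_div]
  rw [h]
  exact (Complex.isPrimitiveRoot_exp n hn).inv

theorem dftMatrix_transpose (n : ℕ) : (dftMatrix n)ᵀ = dftMatrix n := by
  ext j k
  simp [dftMatrix, mul_comm]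

theorem conj_dftMatrix_mul_dftMatrix {n : ℕ} (hn : n ≠ 0) :
    (dftMatrix n).map (starRingEnd ℂ) * dftMatrix n = (n : ℂ) • 1 := by
  have hω := isPrimitiveRoot_ω hn
  have hunit : starRingEnd ℂ (ω n) * ω n = 1 := by
    rw [← Complex.normSq_eq_conj_mul_self, Complex.normSq_eq_norm_sq,
      hω.norm'_eq_one hn]
    simp
  ext j l
  set z : ℂ := starRingEnd ℂ (ω n) ^ j.val * ω n ^ l.val with hz
  have hsum : ((dftMatrix n).map (starRingEnd ℂ) * dftMatrix n) j l
      = ∑ k ∈ Finset.range n, z ^ k := by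
    rw [Matrix.mul_apply, Finset.sum_range]
    refine Finset.sum_congr rfl fun k _ => ?_
    simp only [dftMatrix, Matrix.map_apply, map_pow, hz, mul_pow, ← pow_mul]
    rw [mul_comm k.val l.val]
  rw [hsum]
  by_cases hjl : j = l
  · subst hjl
    have hz1 : z = 1 := by rw [hz, ← mul_pow, hunit, one_pow]
    simp [hz1]
  · have hzn : z ^ n = 1 := by
      rw [hz, mul_pow, ← pow_mul, ← pow_mul, mul_comm _ n, mul_comm _ n, pow_mul, pow_mul,
        ← map_pow, hω.pow_eq_one]
      simp
    have hz1 : z ≠ 1 := by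
      intro h
      apply hjl
      apply Fin.ext
      refine hω.pow_inj j.isLt l.isLt ?_
      calc ω n ^ j.val = ω n ^ j.val * z := by rw [h, mul_one]
        _ = (starRingEnd ℂ (ω n) * ω n) ^ j.val * ω n ^ l.val := by rw [hz]; ring
        _ = ω n ^ l.val := by rw [hunit, one_pow, one_mul]
    rw [geom_sum_eq hz1, hzn]
    simp [hjl]

section Kron

variable {d : ℕ} {n : Fin d → ℕ}

theorem kron_mul (M N : ∀ i : Fin d, Matrix (Fin (n i)) (Fin (n i)) ℂ) :
    kron M * kron N = kron fun i => M i * N i := by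
  ext j k
  simp only [kron, Matrix.mul_apply, ← Finset.prod_mul_distrib]
  rw [Finset.prod_univ_sum, Fintype.piFinset_univ]

theorem kron_smul_one (c : Fin d → ℂ) :
    kron (fun i => c i • (1 : Matrix (Fin (n i)) (Fin (n i)) ℂ)) = (∏ i, c i) • 1 := by
  ext j k
  simp only [kron, Matrix.smul_apply, smul_eq_mul, Finset.prod_mul_distrib, Matrix.one_apply]
  congr 1
  rw [Fintype.prod_ite_zero]
  simp [funext_iff]

/-- The Kronecker product of permutation matrices acts by permuting coordinates. -/
theorem kron_mulVec_of_perm (P : ∀ i : Fin d, Matrix (Fin (n i)) (Fin (n i)) ℂ)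
    (σ : ∀ i : Fin d, Equiv.Perm (Fin (n i)))
    (hP : ∀ i j k, P i j k = if k = σ i j then 1 else 0)
    (v : (∀ i : Fin d, Fin (n i)) → ℂ) (j : ∀ i : Fin d, Fin (n i)) :
    (kron P).mulVec v j = v fun i => σ i (j i) := by
  have h : ∀ k, kron P j k = if k = (fun i => σ i (j i)) then 1 else 0 := by
    intro k
    simp only [kron, hP]
    rw [Fintype.prod_ite_zero]
    simp [funext_iff]
  simp [Matrix.mulVec, dotProduct, h]

/-- The scaled inverse of the multi-dimensional DFT matrix. -/
theorem inv_kron_dftMatrix (hn : ∀ i, n i ≠ 0) :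
    (kron fun i => dftMatrix (n i))⁻¹
      = ((1 : ℂ) / ∏ i, (n i : ℂ)) • kron fun i => (dftMatrix (n i)).map (starRingEnd ℂ) := by
  apply Matrix.inv_eq_left_inv
  have hN : ∏ i, (n i : ℂ) ≠ 0 :=
    Finset.prod_ne_zero_iff.mpr fun i _ => Nat.cast_ne_zero.mpr (hn i)
  rw [Matrix.smul_mul, kron_mul]
  simp only [conj_dftMatrix_mul_dftMatrix (hn _)]
  rw [kron_smul_one, smul_smul, one_div_mul_cancel hN, one_smul]

end Kron

/-- Permutation-avoiding multi-dimensional convolution: if each `F_{n_i} = A_i · P_i` with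
`P_i` symmetric permutation matrices, then
`K(conj F) · (g ∘ (K(F)·x)) = K(conj A) · ((K(P)·g) ∘ (K(Aᵀ)·x))`, and dividing by
`N = Π n_i` identifies the left-hand side with the `d`-dimensional discrete convolution
`K(F)⁻¹ · diag(g) · K(F) · x`, since `K(F)⁻¹ = (1/N) • K(conj F)`. -/
theorem stmt8 (d : ℕ) (hd : 1 ≤ d) (n : Fin d → ℕ) (hn : ∀ i, 1 ≤ n i)
    (A P : ∀ i : Fin d, Matrix (Fin (n i)) (Fin (n i)) ℂ)
    (σ : ∀ i : Fin d, Equiv.Perm (Fin (n i)))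
    (hP : ∀ i j k, P i j k = if j = σ i k then 1 else 0)
    (hPsym : ∀ i, P i = (P i)ᵀ)
    (hF : ∀ i, dftMatrix (n i) = A i * P i)
    (g x : (∀ i : Fin d, Fin (n i)) → ℂ) :
    (kron (fun i => (dftMatrix (n i)).map (starRingEnd ℂ))).mulVec
        (fun j => g j * (kron (fun i => dftMatrix (n i))).mulVec x j)
      = (kron (fun i => (A i).map (starRingEnd ℂ))).mulVec
          (fun j => (kron P).mulVec g j * (kron (fun i => (A i)ᵀ)).mulVec x j) ∧
    ((kron (fun i => dftMatrix (n i)))⁻¹ * Matrix.diagonal g *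
        kron (fun i => dftMatrix (n i))).mulVec x
      = ((1 : ℂ) / (∏ i : Fin d, (n i : ℂ))) •
          (kron (fun i => (A i).map (starRingEnd ℂ))).mulVec
            (fun j => (kron P).mulVec g j * (kron (fun i => (A i)ᵀ)).mulVec x j) := by
  have hPsym' : ∀ i j k, P i j k = P i k j := fun i j k => congrFun (congrFun (hPsym i) j) k
  have hP' : ∀ i j k, P i j k = if k = σ i j then 1 else 0 := fun i j k => by
    rw [hPsym', hP]
  have hσ : ∀ i j, σ i (σ i j) = j := by
    intro i j
    have h := hP i j (σ i j)
    rw [hP', if_pos rfl] at h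
    by_contra hne
    rw [if_neg (Ne.symm hne)] at h
    exact one_ne_zero h
  have hFt : ∀ i, dftMatrix (n i) = P i * (A i)ᵀ := fun i => by
    rw [← dftMatrix_transpose, hF, Matrix.transpose_mul, ← hPsym]
  have hFc : ∀ i, (dftMatrix (n i)).map (starRingEnd ℂ)
      = (A i).map (starRingEnd ℂ) * P i := fun i => by
    have hPc : (P i).map (starRingEnd ℂ) = P i := by
      ext j k
      simp [hP, apply_ite (starRingEnd ℂ)]
    rw [hF, Matrix.map_mul, hPc]
  have hconv : (kron (fun i => (dftMatrix (n i)).map (starRingEnd ℂ))).mulVec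
        (fun j => g j * (kron (fun i => dftMatrix (n i))).mulVec x j)
      = (kron (fun i => (A i).map (starRingEnd ℂ))).mulVec
          (fun j => (kron P).mulVec g j * (kron (fun i => (A i)ᵀ)).mulVec x j) := by
    have hK : (kron fun i => dftMatrix (n i)) = kron P * kron fun i => (A i)ᵀ := by
      rw [kron_mul]
      exact congrArg kron (funext hFt)
    have hKc : (kron fun i => (dftMatrix (n i)).map (starRingEnd ℂ))
        = (kron fun i => (A i).map (starRingEnd ℂ)) * kron P := by
      rw [kron_mul]
      exact congrArg kron (funext hFc)
    rw [hK, hKc, ← Matrix.mulVec_mulVec]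
    congr 1
    funext j
    rw [← Matrix.mulVec_mulVec]
    simp only [kron_mulVec_of_perm P σ hP', hσ]
  refine ⟨hconv, ?_⟩
  rw [inv_kron_dftMatrix fun i => Nat.one_le_iff_ne_zero.mp (hn i), ← hconv, Matrix.smul_mul,
    Matrix.smul_mul, Matrix.smul_mulVec, ← Matrix.mulVec_mulVec, ← Matrix.mulVec_mulVec]
  congr 2
  funext j
  rw [Matrix.mulVec_diagonal]
end

section
/- General-radix Cooley–Tukey factorization: let r ≥ 2, t ≥ 1 and n = r^t. For k a power of r, let B_{r,k} be the k×k matrix with entries B_{r,k}(a + (k/r)·u, a' + (k/r)·u') = ω_r^{u·u'} · ω_k^{a·u'} if a = a' and 0 otherwise (0 ≤ a, a' < k/r, 0 ≤ u, u' < r), and for m a power of r let R_{r,m} be the m×m permutation matrix determined by (R_{r,m}·x)(d + (m/r)·c) = x(c + r·d) for 0 ≤ c < r, 0 ≤ d < m/r. For 1 ≤ q ≤ t, let B^{(q)} be the n×n block-diagonal matrix consisting of n/r^q copies of B_{r,r^q}, and R^{(q)} the n×n block-diagonal matrix consisting of r^{q−1} copies of R_{r, n/r^{q−1}}. Then F_n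 = B^{(t)} · B^{(t−1)} · ⋯ · B^{(1)} · R^{(t)} · R^{(t−1)} · ⋯ · R^{(1)}. -/
open Matrix Complex

/-- The `n × n` block-diagonal matrix consisting of `n/k` copies of the `k × k` matrix
given entrywise by `M`: entry `(s·k + a, s'·k + a') = M a a'` if `s = s'`, else `0`. -/
noncomputable def blockDiag (n k : ℕ) (M : ℕ → ℕ → ℂ) : Matrix (Fin n) (Fin n) ℂ :=
  fun x y => if x.val / k = y.val / k then M (x.val % k) (y.val % k) else 0

/-- Entries of the radix-`r` butterfly matrix `B_{r,k}`:
`B_{r,k}(a + (k/r)·u, a' + (k/r)·u') = ω_r^{u·u'} · ω_k^{a·u'}` if `a = a'`, else `0`. -/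
noncomputable def butterflyFun (r k : ℕ) : ℕ → ℕ → ℂ :=
  fun p q =>
    if p % (k / r) = q % (k / r)
    then ω r ^ (p / (k / r) * (q / (k / r))) * ω k ^ (p % (k / r) * (q / (k / r)))
    else 0

/-- Entries of the modulo-`r` sort permutation matrix `R_{r,m}`, determined by
`(R_{r,m}·x)(d + (m/r)·c) = x(c + r·d)` for `0 ≤ c < r`, `0 ≤ d < m/r`. -/
noncomputable def modSortFun (r m : ℕ) : ℕ → ℕ → ℂ :=
  fun j k => if k = j / (m / r) + r * (j % (m / r)) then 1 else 0

/-- Entries of the `m × m` DFT matrix, as a function of natural number indices. -/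
noncomputable def dftFun (m : ℕ) : ℕ → ℕ → ℂ := fun j k => ω m ^ (j * k)

theorem omega_pow_self {n : ℕ} (hn : n ≠ 0) : ω n ^ n = 1 := by
  have hn' : (n : ℂ) ≠ 0 := Nat.cast_ne_zero.mpr hn
  rw [ω, ← Complex.exp_nat_mul, mul_div_cancel₀ _ hn', Complex.exp_neg, Complex.exp_two_pi_mul_I,
    inv_one]

theorem omega_mul_pow {a b : ℕ} (ha : a ≠ 0) : ω (a * b) ^ a = ω b := by
  have ha' : (a : ℂ) ≠ 0 := Nat.cast_ne_zero.mpr ha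
  rw [ω, ω, ← Complex.exp_nat_mul, Nat.cast_mul, ← mul_div_assoc, mul_div_mul_left _ _ ha']

theorem blockDiag_dftFun_one (n : ℕ) : blockDiag n 1 (dftFun 1) = 1 := by
  ext x y
  simp [_root_.blockDiag, dftFun, Matrix.one_apply, Fin.ext_iff, Nat.mod_one]

theorem blockDiag_dftFun_self (n : ℕ) : blockDiag n n (dftFun n) = dftMatrix n := by
  ext x y
  simp [_root_.blockDiag, dftFun, dftMatrix, Nat.div_eq_of_lt, Nat.mod_eq_of_lt]

/-- The twiddle factor identity behind one decimation-in-time step of the DFT. -/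
theorem omega_mul_pow_mul {r m : ℕ} (hr : r ≠ 0) (hm : m ≠ 0) (a u u' d : ℕ) :
    ω r ^ (u * u') * ω (r * m) ^ (a * u') * ω m ^ (a * d)
      = ω (r * m) ^ ((a + m * u) * (u' + r * d)) := by
  have h₁ : ω r = ω (r * m) ^ m := by rw [mul_comm r m, omega_mul_pow hm]
  have h₂ : ω m = ω (r * m) ^ r := (omega_mul_pow hr).symm
  rw [h₁, h₂, ← pow_mul, ← pow_mul, ← pow_add, ← pow_add]
  have h₃ : (a + m * u) * (u' + r * d)
      = m * (u * u') + a * u' + r * (a * d) + (r * m) * (u * d) := by ring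
  rw [h₃, pow_add _ _ (r * m * (u * d)), pow_mul _ (r * m), omega_pow_self (mul_ne_zero hr hm),
    one_pow, mul_one]

theorem add_mul_mul_lt {r m c i j a : ℕ} (hi : i < c) (hj : j < r) (ha : a < m) :
    a + m * (j + r * i) < r * m * c := by
  have h₁ : j + r * i + 1 ≤ r * c := by nlinarith
  nlinarith

/-- Uniqueness of mixed-radix digits. -/
theorem digits_eq {r m i j a x : ℕ} (hm : 0 < m) (hj : j < r) (ha : a < m)
    (hx : x = a + m * (j + r * i)) :
    x / (r * m) = i ∧ x % (r * m) = a + m * j ∧ x / m = j + r * i ∧ x % m = a := by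
  have hd : x / m = j + r * i := by
    rw [hx, Nat.add_mul_div_left _ _ hm, Nat.div_eq_of_lt ha, zero_add]
  have hdk : x / (r * m) = i := by
    rw [mul_comm, ← Nat.div_div_eq_div_mul, hd, Nat.add_mul_div_left _ _ (by omega),
      Nat.div_eq_of_lt hj, zero_add]
  refine ⟨hdk, ?_, hd, ?_⟩
  · have := Nat.mod_add_div x (r * m)
    rw [hdk] at this
    have h' : a + m * (j + r * i) = a + m * j + r * m * i := by ring
    omega
  · rw [hx, Nat.add_mul_mod_self_left, Nat.mod_eq_of_lt ha]

theorem exists_digits {r m c x : ℕ} (hm : 0 < m) (hr : 0 < r) (hx : x < r * m * c) :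
    ∃ i < c, ∃ j < r, ∃ a < m, x = a + m * (j + r * i) := by
  refine ⟨x / m / r, ?_, x / m % r, Nat.mod_lt _ hr, x % m, Nat.mod_lt _ hm, ?_⟩
  · rw [Nat.div_div_eq_div_mul]
    exact Nat.div_lt_of_lt_mul (by rwa [mul_comm m r])
  · rw [Nat.mod_add_div, Nat.mod_add_div]

/-- Right multiplication by a block-diagonal mod-`r` sort permutes the columns. -/
theorem mul_blockDiag_modSortFun_apply {n r m c : ℕ} (hn : n = r * m * c) (hm : 0 < m)
    (A : Matrix (Fin n) (Fin n) ℂ) (x y w : Fin n) {i j d : ℕ} (hj : j < r) (hd : d < m)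
    (hy : y.val = j + r * (d + m * i)) (hw : w.val = d + m * (j + r * i)) :
    (A * blockDiag n (r * m) (modSortFun r (r * m))) x y = A x w := by
  have hr : 0 < r := by omega
  have hq : r * m / r = m := Nat.mul_div_cancel_left m hr
  obtain ⟨y₁, y₂, -, -⟩ := digits_eq (r := m) hr hd hj hy
  rw [mul_comm m r] at y₁ y₂
  rw [Matrix.mul_apply, Finset.sum_eq_single w]
  · obtain ⟨w₁, w₂, -, -⟩ := digits_eq hm hj hd hw
    simp [_root_.blockDiag, modSortFun, hq, w₁, w₂, y₁, y₂, Nat.add_mul_div_left _ _ hm,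
      Nat.div_eq_of_lt hd, Nat.mod_eq_of_lt hd]
  · intro z _ hz
    obtain ⟨i', -, j', hj', d', hd', hz'⟩ := exists_digits hm hr (z.isLt.trans_eq hn)
    obtain ⟨z₁, z₂, -, -⟩ := digits_eq hm hj' hd' hz'
    simp only [_root_.blockDiag, modSortFun, hq, z₁, z₂, y₁, y₂, Nat.add_mul_div_left _ _ hm,
      Nat.div_eq_of_lt hd', Nat.mod_eq_of_lt hd', Nat.add_mul_mod_self_left, zero_add]
    rw [ite_eq_right_iff.mpr, mul_zero]
    intro hi
    rw [if_neg]
    intro h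
    have hjj : j = j' := by
      simpa [Nat.mod_eq_of_lt hj, Nat.mod_eq_of_lt hj'] using congrArg (· % r) h
    subst hjj
    have hdd : d = d' := Nat.eq_of_mul_eq_mul_left hr (by omega)
    exact hz (Fin.ext (by rw [hz', hw, hi, hdd]))
  · simp

/-- One decimation-in-time step, applied to every diagonal block. -/
theorem blockDiag_dftFun_mul {n r m c : ℕ} (hn : n = r * m * c) (hr : 0 < r) (hm : 0 < m) :
    blockDiag n (r * m) (dftFun (r * m))
      = blockDiag n (r * m) (butterflyFun r (r * m)) *
        (blockDiag n m (dftFun m) * blockDiag n (r * m) (modSortFun r (r * m))) := by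
  have hq : r * m / r = m := Nat.mul_div_cancel_left m hr
  ext x y
  obtain ⟨i, hi, u, hu, a, ha, hx⟩ := exists_digits hm hr (x.isLt.trans_eq hn)
  obtain ⟨i', hi', d, hd, j, hj, hy⟩ :=
    exists_digits (r := m) (m := r) (c := c) hr hm (by rw [mul_comm m r]; exact y.isLt.trans_eq hn)
  obtain ⟨y₁, y₂, -, -⟩ := digits_eq (r := m) hr hd hj hy
  rw [mul_comm m r] at y₁ y₂
  obtain ⟨x₁, x₂, -, -⟩ := digits_eq hm hu ha hx
  let w : Fin n := ⟨d + m * (j + r * i'), hn ▸ add_mul_mul_lt hi' hj hd⟩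
  let z : Fin n := ⟨a + m * (j + r * i'), hn ▸ add_mul_mul_lt hi' hj ha⟩
  obtain ⟨-, -, w₃, w₄⟩ := digits_eq hm hj hd (rfl : w.val = _)
  obtain ⟨z₁, z₂, z₃, z₄⟩ := digits_eq hm hj ha (rfl : z.val = _)
  rw [← Matrix.mul_assoc, mul_blockDiag_modSortFun_apply hn hm _ x y w hj hd hy rfl,
    Matrix.mul_apply, Finset.sum_eq_single z]
  · simp only [_root_.blockDiag, butterflyFun, dftFun, hq, x₁, x₂, y₁, y₂, z₁, z₂, z₃, z₄, w₃, w₄,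
      Nat.add_mul_div_left _ _ hm, Nat.div_eq_of_lt ha, Nat.mod_eq_of_lt ha,
      Nat.add_mul_mod_self_left, zero_add, if_true]
    split_ifs
    · exact (omega_mul_pow_mul hr.ne' hm.ne' a u j d).symm
    · rw [zero_mul]
  · intro v _ hv
    obtain ⟨k, -, l, hl, b, hb, hv'⟩ := exists_digits hm hr (v.isLt.trans_eq hn)
    obtain ⟨v₁, v₂, v₃, v₄⟩ := digits_eq hm hl hb hv'
    simp only [_root_.blockDiag, butterflyFun, hq, x₁, x₂, v₁, v₂, v₃, v₄, w₃, w₄,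
      Nat.mod_eq_of_lt ha, Nat.mod_eq_of_lt hb, Nat.add_mul_mod_self_left]
    by_cases hab : a = b
    · rw [if_neg (c := l + r * k = j + r * i'), mul_zero]
      intro h
      exact hv (Fin.ext (by rw [hv', h, ← hab]))
    · simp [hab]
  · simp

theorem blockDiag_dftFun_eq_prod {r t : ℕ} (hr : 0 < r) (s : ℕ) (hs : s ≤ t) :
    blockDiag (r ^ t) (r ^ s) (dftFun (r ^ s))
      = ((List.range s).reverse.map (fun q =>
            blockDiag (r ^ t) (r ^ (q + 1)) (butterflyFun r (r ^ (q + 1))))).prod *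
        ((List.range s).map (fun q =>
            blockDiag (r ^ t) (r ^ (q + 1)) (modSortFun r (r ^ (q + 1))))).prod := by
  induction s with
  | zero => simp [blockDiag_dftFun_one]
  | succ s ih =>
    have hn : r ^ t = r * r ^ s * r ^ (t - (s + 1)) := by
      rw [← pow_succ', ← pow_add, Nat.add_sub_cancel' hs]
    have step := blockDiag_dftFun_mul hn hr (pow_pos hr s)
    rw [← pow_succ', ih (by omega)] at step
    simpa [List.range_succ, Matrix.mul_assoc] using step

/-- General-radix Cooley–Tukey factorization: for `n = r^t`,
`F_n = B^{(t)} ⋯ B^{(1)} · R^{(t)} ⋯ R^{(1)}`, where `B^{(q)}` is block-diagonal with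
`n/r^q` copies of `B_{r,r^q}` and `R^{(q)}` is block-diagonal with `r^{q−1}` copies of
`R_{r, n/r^{q−1}}`. -/
theorem stmt14 (r t : ℕ) (hr : 2 ≤ r) (ht : 1 ≤ t) :
    dftMatrix (r ^ t)
      = ((List.range t).reverse.map (fun q =>
            blockDiag (r ^ t) (r ^ (q + 1)) (butterflyFun r (r ^ (q + 1))))).prod *
        ((List.range t).reverse.map (fun q =>
            blockDiag (r ^ t) (r ^ t / r ^ q) (modSortFun r (r ^ t / r ^ q)))).prod := by
  have hr0 : 0 < r := by omega
  rw [← blockDiag_dftFun_self, blockDiag_dftFun_eq_prod hr0 t le_rfl]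
  congr 2
  have hrev : (List.range t).reverse = (List.range t).map (t - 1 - ·) := by
    conv_lhs => rw [List.range_eq_range', List.reverse_range', zero_add]
  rw [hrev, List.map_map]
  refine List.map_congr_left fun q hq => ?_
  have hq' : q < t := List.mem_range.mp hq
  have h : r ^ t / r ^ (t - 1 - q) = r ^ (q + 1) := by
    rw [Nat.pow_div (by omega) hr0]
    congr 1
    omega
  simp only [Function.comp_apply, h]
end
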